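/- Let k be a field of characteristic p > 0, let α be a natural number, set q = p^α, and write V_s for the k[x]-module k[x]/(x−1)^s (with V_0 = 0). For every integer r with 1 ≤ r ≤ q there is an isomorphism of k[x]-modules (V_{q+1} ⊗ V_r) ⊕ V_{q−r} ≅ (V_{q−1} ⊗ V_r) ⊕ V_{r+q}. -/

import Mathlib

open Polynomial TensorProduct

/-- The `k`-linear operator on the `k[x]`-module `k[x]/(h)` given by the action of `x`,
i.e. multiplication by `x`. -/
noncomputable def mulXop (k : Type*) [Field k] (h : k[X]) :
    (k[X] ⧸ Ideal.span {h}) →ₗ[k] (k[X] ⧸ Ideal.span {h}) :=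
  LinearMap.mulLeft k (Ideal.Quotient.mk (Ideal.span {h}) X)

/-- Two `k[x]`-modules, presented as vector spaces equipped with the `k`-linear operator
by which `x` acts, are isomorphic iff there is a `k`-linear equivalence intertwining the
two operators. -/
def OpIso {k V W : Type*} [Field k] [AddCommGroup V] [Module k V]
    [AddCommGroup W] [Module k W] (f : V →ₗ[k] V) (g : W →ₗ[k] W) : Prop :=
  ∃ e : V ≃ₗ[k] W, ∀ v, e (f v) = g (e v)

/-- The direct sum of a family of operators, as an operator on the direct sum
(product) of the underlying spaces. -/
def piOp {k : Type*} [Field k] {ι : Type*} {V : ι → Type*} [∀ i, AddCommGroup (V i)]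
    [∀ i, Module k (V i)] (f : ∀ i, V i →ₗ[k] V i) : (∀ i, V i) →ₗ[k] (∀ i, V i) :=
  LinearMap.pi fun i => (f i).comp (LinearMap.proj i)


theorem OpIso.symm' {k V W : Type*} [Field k] [AddCommGroup V] [Module k V]
    [AddCommGroup W] [Module k W] {f : V →ₗ[k] V} {g : W →ₗ[k] W} (h : OpIso f g) :
    OpIso g f := by
  obtain ⟨e, he⟩ := h
  refine ⟨e.symm, fun w => ?_⟩
  rw [LinearEquiv.symm_apply_eq, he, LinearEquiv.apply_symm_apply]

theorem OpIso.final {k V W A B P : Type*} [Field k] [AddCommGroup V] [Module k V]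
    [AddCommGroup W] [Module k W] [AddCommGroup A] [Module k A]
    [AddCommGroup B] [Module k B] [AddCommGroup P] [Module k P]
    {f : V →ₗ[k] V} {g : W →ₗ[k] W} {a : A →ₗ[k] A} {b : B →ₗ[k] B} {c : P →ₗ[k] P}
    (h1 : OpIso (a.prodMap c) f) (h2 : OpIso (b.prodMap c) g) :
    OpIso (f.prodMap b) (g.prodMap a) := by
  obtain ⟨e1, h1⟩ := h1.symm'
  obtain ⟨e2, h2⟩ := h2
  let m : ((A × P) × B) ≃ₗ[k] ((B × P) × A) :=
    { toFun := fun x => ((x.2, x.1.2), x.1.1)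
      invFun := fun x => ((x.2, x.1.2), x.1.1)
      map_add' := fun _ _ => rfl
      map_smul' := fun _ _ => rfl
      left_inv := fun _ => rfl
      right_inv := fun _ => rfl }
  refine ⟨(e1.prodCongr (LinearEquiv.refl k B)).trans
    (m.trans (e2.prodCongr (LinearEquiv.refl k A))), ?_⟩
  rintro ⟨v, y⟩
  simp [m, h1, ← h2]

theorem exists_quotMap {k A : Type*} [Field k] [CommRing A] [Algebra k A] (h : k[X]) (T w : A)
    (hw : aeval T h * w = 0) :
    ∃ φ : (k[X] ⧸ Ideal.span {h}) →ₗ[k] A,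
      ∀ P : k[X], φ (Ideal.Quotient.mk _ P) = aeval T P * w := by
  let ψ : k[X] →ₗ[k] A := (LinearMap.mulRight k w).comp (aeval T).toLinearMap
  have hψ : (Ideal.span {h}).restrictScalars k ≤ LinearMap.ker ψ := by
    intro x hx
    obtain ⟨c, rfl⟩ := Ideal.mem_span_singleton'.1 ((Submodule.restrictScalars_mem _ _ _).1 hx)
    simp [ψ, mul_assoc, hw]
  refine ⟨(Submodule.liftQ _ ψ hψ).comp
    (Submodule.Quotient.restrictScalarsEquiv k (Ideal.span {h})).symm.toLinearMap, fun P => ?_⟩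
  rfl

theorem finite_quot {k : Type*} [Field k] (n : ℕ) :
    Module.Finite k (k[X] ⧸ Ideal.span {((X - 1 : k[X])) ^ n}) := by
  have h : ((X - 1 : k[X]) ^ n).Monic := by
    simpa using (monic_X_sub_C (1 : k)).pow n
  exact h.finite_adjoinRoot

theorem finrank_quot {k : Type*} [Field k] (n : ℕ) :
    Module.finrank k (k[X] ⧸ Ideal.span {((X - 1 : k[X])) ^ n}) = n := by
  rw [finrank_quotient_span_eq_natDegree, natDegree_pow]
  have : (X - 1 : k[X]).natDegree = 1 := by simpa using natDegree_X_sub_C (1 : k)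
  rw [this, mul_one]

theorem decomp {k A : Type*} [Field k] [CommRing A] [Algebra k A] (T w : A) (s q n : ℕ)
    (c : Fin n → A) (hw : (T - 1) ^ s * w = 0) (hc : ∀ j, (T - 1) ^ q * c j = 0)
    (hA : Module.finrank k A = s + n * q) (hfin : Module.Finite k A)
    (hgen : ∀ N : Submodule k A, (∀ a ∈ N, T * a ∈ N) → w ∈ N → (∀ j, c j ∈ N) → N = ⊤) :
    OpIso ((mulXop k ((X - 1) ^ s)).prodMap (piOp fun _ : Fin n => mulXop k ((X - 1) ^ q)))
      (LinearMap.mulLeft k T) := by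
  obtain ⟨φ, hφ⟩ := exists_quotMap (k := k) ((X - 1) ^ s) T w (by simpa using hw)
  have := fun j => exists_quotMap (k := k) ((X - 1) ^ q) T (c j) (by simpa using hc j)
  choose ψ hψ using this
  have hφX : ∀ v, φ (mulXop k _ v) = T * φ v := by
    intro v
    obtain ⟨P, rfl⟩ := Ideal.Quotient.mk_surjective v
    simp only [mulXop, LinearMap.mulLeft_apply, ← map_mul]
    rw [hφ, hφ]; simp [mul_assoc]
  have hψX : ∀ j v, ψ j (mulXop k _ v) = T * ψ j v := by
    intro j v
    obtain ⟨P, rfl⟩ := Ideal.Quotient.mk_surjective v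
    simp only [mulXop, LinearMap.mulLeft_apply, ← map_mul]
    rw [hψ, hψ]; simp [mul_assoc]
  let Φ : ((k[X] ⧸ Ideal.span {((X - 1 : k[X])) ^ s}) ×
      (Fin n → (k[X] ⧸ Ideal.span {((X - 1 : k[X])) ^ q}))) →ₗ[k] A :=
    φ.coprod (∑ j, (ψ j).comp (LinearMap.proj j))
  have hΦX : ∀ v, Φ ((mulXop k ((X - 1) ^ s)).prodMap
      (piOp fun _ : Fin n => mulXop k ((X - 1) ^ q)) v) = T * Φ v := by
    rintro ⟨v, u⟩
    simp [Φ, hφX, hψX, piOp, mul_add, Finset.mul_sum]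
  have hsurj : LinearMap.range Φ = ⊤ := by
    apply hgen
    · rintro _ ⟨v, rfl⟩
      exact ⟨_, hΦX v⟩
    · refine ⟨(Ideal.Quotient.mk _ 1, 0), ?_⟩
      simp only [Φ, LinearMap.coprod_apply, hφ]
      simp
    · intro j
      refine ⟨(0, Pi.single j (Ideal.Quotient.mk _ 1)), ?_⟩
      simp only [Φ, LinearMap.coprod_apply, LinearMap.sum_apply, LinearMap.comp_apply,
        LinearMap.proj_apply]
      rw [Finset.sum_eq_single j]
      · rw [Pi.single_eq_same, hψ]; simp
      · intro i _ hij
        rw [Pi.single_eq_of_ne hij]; simp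
      · simp
  have := finite_quot (k := k) s
  have := finite_quot (k := k) q
  have hdim : Module.finrank k ((k[X] ⧸ Ideal.span {((X - 1 : k[X])) ^ s}) ×
      (Fin n → (k[X] ⧸ Ideal.span {((X - 1 : k[X])) ^ q}))) = Module.finrank k A := by
    rw [Module.finrank_prod, Module.finrank_pi_fintype, hA, finrank_quot]
    simp [finrank_quot]
  have hs : Function.Surjective Φ := LinearMap.range_eq_top.1 hsurj
  have hi : Function.Injective Φ :=
    (LinearMap.injective_iff_surjective_of_finrank_eq_finrank hdim).2 hs
  exact ⟨LinearEquiv.ofBijective Φ ⟨hi, hs⟩, fun v => hΦX v⟩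

theorem char_ids {k A : Type*} [Field k] (p : ℕ) [CharP k p] (hp : p.Prime) (α q : ℕ)
    (hq : q = p ^ α) [CommRing A] [Algebra k A] (t b : A) :
    (t - b) ^ q = t ^ q - b ^ q ∧
    (t - b) ^ (q - 1) = ∑ i ∈ Finset.range q, t ^ i * b ^ (q - 1 - i) := by
  have : Fact p.Prime := ⟨hp⟩
  have hq0 : q ≠ 0 := by rw [hq]; exact pow_ne_zero _ hp.ne_zero
  have key : ∀ x y : MvPolynomial (Fin 2) k, (x - y) ^ q = x ^ q - y ^ q := by
    intro x y; rw [hq]; exact sub_pow_char_pow x y α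
  have key2 : ((MvPolynomial.X 0 - MvPolynomial.X 1 : MvPolynomial (Fin 2) k)) ^ (q - 1) =
      ∑ i ∈ Finset.range q, MvPolynomial.X 0 ^ i * MvPolynomial.X 1 ^ (q - 1 - i) := by
    have hne : (MvPolynomial.X 0 - MvPolynomial.X 1 : MvPolynomial (Fin 2) k) ≠ 0 := by
      rw [sub_ne_zero]
      intro h
      have := MvPolynomial.X_injective h
      simp at this
    apply mul_right_cancel₀ hne
    rw [geom_sum₂_mul, ← key, ← pow_succ, Nat.sub_add_cancel (Nat.one_le_iff_ne_zero.2 hq0)]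
  constructor
  · simpa using congrArg (MvPolynomial.aeval ![t, b]) (key (MvPolynomial.X 0) (MvPolynomial.X 1))
  · simpa using congrArg (MvPolynomial.aeval ![t, b]) key2

/-- reduction of generation to containing all powers of `b`. -/
theorem gen_pow {k A : Type*} [Field k] [CommRing A] [Algebra k A] (T b : A) (r : ℕ)
    (hb : b ^ r = 0)
    (hgen : ∀ K : Submodule k A, 1 ∈ K → (∀ a ∈ K, T * a ∈ K) → (∀ a ∈ K, b * a ∈ K) → K = ⊤)
    (N : Submodule k A) (hT : ∀ a ∈ N, T * a ∈ N) (h : ∀ j < r, b ^ j ∈ N) : N = ⊤ := by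
  let K : Submodule k A := ⨅ j : ℕ, N.comap (LinearMap.mulLeft k (b ^ j))
  have hK : ∀ a, a ∈ K ↔ ∀ j : ℕ, b ^ j * a ∈ N := by
    intro a; simp [K, Submodule.mem_iInf]
  have : K = ⊤ := by
    apply hgen
    · rw [hK]
      intro j
      rw [mul_one]
      rcases lt_or_ge j r with hj | hj
      · exact h j hj
      · rw [pow_eq_zero_of_le hj hb]; exact N.zero_mem
    · intro a ha
      rw [hK] at ha ⊢
      intro j
      rw [mul_left_comm]
      exact hT _ (ha j)
    · intro a ha
      rw [hK] at ha ⊢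
      intro j
      rw [← mul_assoc, ← pow_succ]
      exact ha _
  rw [eq_top_iff]
  intro a _
  have ha : a ∈ K := by rw [this]; trivial
  simpa using (hK a).1 ha 0

theorem case_minus {k A : Type*} [Field k] (p : ℕ) [CharP k p] (hp : p.Prime) (α q : ℕ)
    (hq : q = p ^ α) [CommRing A] [Algebra k A] (hfin : Module.Finite k A) (T y : A) (r : ℕ)
    (hr1 : 1 ≤ r) (hrq : r ≤ q)
    (hb : (y - 1) ^ r = 0) (h0 : (T - y) ^ (q - 1) = 0) (hA : Module.finrank k A = (q - 1) * r)
    (hgen : ∀ K : Submodule k A, 1 ∈ K → (∀ a ∈ K, T * a ∈ K) → (∀ a ∈ K, (y - 1) * a ∈ K) →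
      K = ⊤) :
    OpIso ((mulXop k ((X - 1) ^ (q - r))).prodMap
      (piOp fun _ : Fin (r - 1) => mulXop k ((X - 1) ^ q))) (LinearMap.mulLeft k T) := by
  obtain ⟨b, rfl⟩ : ∃ b, y = b + 1 := ⟨y - 1, by ring⟩
  obtain ⟨t, rfl⟩ : ∃ t, T = t + 1 := ⟨T - 1, by ring⟩
  rw [add_sub_cancel_right] at hb hgen
  rw [add_sub_add_right_eq_sub] at h0
  obtain ⟨e1, e2⟩ := char_ids (k := k) p hp α q hq t b
  have hbq : b ^ q = 0 := pow_eq_zero_of_le hrq hb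
  obtain ⟨m, rfl⟩ : ∃ m, r = m + 1 := ⟨r - 1, by omega⟩
  obtain ⟨d, rfl⟩ : ∃ d, q = d + (m + 1) := ⟨q - (m + 1), by omega⟩
  let w : A := ∑ i ∈ Finset.range (m + 1), t ^ i * b ^ (m - i)
  have hw : t ^ d * w = 0 := by
    rw [← h0, e2, Finset.sum_range_add, Finset.sum_eq_zero, zero_add, Finset.mul_sum]
    · apply Finset.sum_congr rfl
      intro i hi
      rw [pow_add, mul_assoc]
      congr 3
      omega
    · intro i hi
      rw [Finset.mem_range] at hi
      rw [pow_eq_zero_of_le (n := d + (m + 1) - 1 - i) (by omega) hb, mul_zero]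
  have htq : t ^ (d + (m + 1)) = 0 := by
    have : (t - b) ^ (d + (m + 1)) = 0 := pow_eq_zero_of_le (by omega) h0
    rw [e1, hbq, sub_zero] at this
    exact this
  apply decomp (t + 1) w _ _ _ (fun j => b ^ (j : ℕ))
  · simpa using hw
  · intro j; simp [htq]
  · rw [hA]
    have a1 : d + (m + 1) - 1 = d + m := by omega
    have a2 : d + (m + 1) - (m + 1) = d := by omega
    have a3 : m + 1 - 1 = m := by omega
    rw [a1, a2, a3]
    ring
  · exact hfin
  · intro N hT hwN hc
    have ht : ∀ a ∈ N, t * a ∈ N := by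
      intro a ha
      have := N.sub_mem (hT a ha) ha
      convert this using 1; ring
    have htp : ∀ i, ∀ a ∈ N, t ^ i * a ∈ N := by
      intro i a ha
      induction i with
      | zero => simpa
      | succ i ih => rw [pow_succ', mul_assoc]; exact ht _ ih
    refine gen_pow (t + 1) b (m + 1) hb hgen N hT ?_
    have hlow : ∀ j < m, b ^ j ∈ N := fun j hj => hc ⟨j, by simpa using hj⟩
    intro j hj
    rcases lt_or_eq_of_le (Nat.lt_succ_iff.1 hj) with hj | rfl
    · exact hlow j hj
    · have e : b ^ j = w - ∑ i ∈ Finset.range j, t ^ (i + 1) * b ^ (j - (i + 1)) := by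
        simp only [w]
        rw [Finset.sum_range_succ']
        simp
      rw [e]
      refine N.sub_mem hwN (N.sum_mem fun i hi => htp _ _ (hlow _ ?_))
      rw [Finset.mem_range] at hi
      omega

theorem case_plus {k A : Type*} [Field k] (p : ℕ) [CharP k p] (hp : p.Prime) (α q : ℕ)
    (hq : q = p ^ α) [CommRing A] [Algebra k A] (hfin : Module.Finite k A) (T y : A) (r : ℕ)
    (hr1 : 1 ≤ r) (hrq : r ≤ q)
    (hb : (y - 1) ^ r = 0) (h0 : (T - y) ^ (q + 1) = 0) (hA : Module.finrank k A = (q + 1) * r)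
    (hgen : ∀ K : Submodule k A, 1 ∈ K → (∀ a ∈ K, T * a ∈ K) → (∀ a ∈ K, (y - 1) * a ∈ K) →
      K = ⊤) :
    OpIso ((mulXop k ((X - 1) ^ (r + q))).prodMap
      (piOp fun _ : Fin (r - 1) => mulXop k ((X - 1) ^ q))) (LinearMap.mulLeft k T) := by
  obtain ⟨b, rfl⟩ : ∃ b, y = b + 1 := ⟨y - 1, by ring⟩
  obtain ⟨t, rfl⟩ : ∃ t, T = t + 1 := ⟨T - 1, by ring⟩
  rw [add_sub_cancel_right] at hb hgen
  rw [add_sub_add_right_eq_sub] at h0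
  obtain ⟨e1, -⟩ := char_ids (k := k) p hp α q hq t b
  have hbq : b ^ q = 0 := pow_eq_zero_of_le hrq hb
  have hz : t ^ q * (t - b) = 0 := by
    rw [← h0, pow_succ, e1, hbq, sub_zero]
  apply decomp (t + 1) 1 _ _ _ (fun j => (t - b) * b ^ (j : ℕ))
  · have h1 : (∑ i ∈ Finset.range r, t ^ i * b ^ (r - 1 - i)) * (t - b) = t ^ r := by
      rw [geom_sum₂_mul, hb, sub_zero]
    rw [add_sub_cancel_right, mul_one, pow_add, ← h1, mul_assoc, mul_comm (t - b), hz, mul_zero]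
  · intro j
    rw [add_sub_cancel_right, ← mul_assoc, hz, zero_mul]
  · rw [hA]
    obtain ⟨m, rfl⟩ : ∃ m, r = m + 1 := ⟨r - 1, by omega⟩
    simp only [Nat.add_sub_cancel]
    ring
  · exact hfin
  · intro N hT hwN hc
    have ht : ∀ a ∈ N, t * a ∈ N := by
      intro a ha
      have := N.sub_mem (hT a ha) ha
      convert this using 1; ring
    refine gen_pow (t + 1) b r hb hgen N hT ?_
    intro j
    induction j with
    | zero => intro _; simpa using hwN
    | succ j ih =>
      intro hj
      have h1 := N.sub_mem (ht _ (ih (by omega))) (hc ⟨j, by omega⟩)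
      convert h1 using 1
      simp only
      ring

/-- The subalgebra of elements stabilising `K`. -/
def stab {k A : Type*} [Field k] [CommRing A] [Algebra k A] (K : Submodule k A) :
    Subalgebra k A where
  carrier := {a | ∀ n ∈ K, a * n ∈ K}
  mul_mem' := by
    intro a b ha hb n hn
    rw [mul_assoc]
    exact ha _ (hb _ hn)
  add_mem' := by
    intro a b ha hb n hn
    rw [add_mul]
    exact K.add_mem (ha _ hn) (hb _ hn)
  algebraMap_mem' := by
    intro c n hn
    rw [← Algebra.smul_def]
    exact K.smul_mem _ hn

theorem aeval_mem_sub {k A : Type*} [Field k] [CommRing A] [Algebra k A] (S : Subalgebra k A)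
    (x : A) (hx : x ∈ S) (P : k[X]) : aeval x P ∈ S := by
  have h : Algebra.adjoin k {x} ≤ S := Algebra.adjoin_le (by simpa using hx)
  exact h (aeval_mem_adjoin_singleton k x)

theorem tensor_facts {k B C : Type*} [Field k] (p : ℕ) [CharP k p] (hp : p.Prime) (α q : ℕ)
    (hq : q = p ^ α) (m r : ℕ) (hrq : r ≤ q) [CommRing B] [Algebra k B] [CommRing C] [Algebra k C]
    (u : B) (v : C) (hu : (u - 1) ^ m = 0) (hv : (v - 1) ^ r = 0)
    (hus : Function.Surjective (aeval (R := k) u)) (hvs : Function.Surjective (aeval (R := k) v)) :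
    TensorProduct.map (LinearMap.mulLeft k u) (LinearMap.mulLeft k v) =
      LinearMap.mulLeft k (u ⊗ₜ[k] v) ∧
    ((1 : B) ⊗ₜ[k] v - 1) ^ r = 0 ∧ (u ⊗ₜ[k] v - (1 : B) ⊗ₜ[k] v) ^ m = 0 ∧
    (∀ K : Submodule k (B ⊗[k] C), 1 ∈ K → (∀ a ∈ K, u ⊗ₜ[k] v * a ∈ K) →
      (∀ a ∈ K, ((1 : B) ⊗ₜ[k] v - 1) * a ∈ K) → K = ⊤) := by
  have hq0 : q ≠ 0 := by rw [hq]; exact pow_ne_zero _ hp.ne_zero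
  let iL : B →ₐ[k] B ⊗[k] C := Algebra.TensorProduct.includeLeft
  let iR : C →ₐ[k] B ⊗[k] C := Algebra.TensorProduct.includeRight
  obtain ⟨x, hxdef⟩ : ∃ x, x = iL u := ⟨_, rfl⟩
  obtain ⟨y, hydef⟩ : ∃ y, y = iR v := ⟨_, rfl⟩
  have hy1 : (1 : B) ⊗ₜ[k] v = y := by rw [hydef]; rfl
  have hxy : u ⊗ₜ[k] v = x * y := by rw [hxdef, hydef]; simp [iL, iR]
  have hx : (x - 1) ^ m = 0 := by
    rw [hxdef, ← map_one iL, ← map_sub, ← map_pow, hu, map_zero]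
  have hy : (y - 1) ^ r = 0 := by
    rw [hydef, ← map_one iR, ← map_sub, ← map_pow, hv, map_zero]
  have hyq : y ^ q = 1 := by
    have h1 := (char_ids (k := k) p hp α q hq y 1).1
    rw [pow_eq_zero_of_le hrq hy, one_pow] at h1
    exact (sub_eq_zero.1 h1.symm)
  refine ⟨?_, ?_, ?_, ?_⟩
  · apply TensorProduct.ext'
    intro a b
    simp
  · rw [hy1, hy]
  · rw [hy1, hxy]
    have : x * y - y = (x - 1) * y := by ring
    rw [this, mul_pow, hx, zero_mul]
  · rw [hy1, hxy]
    intro K h1 hT hb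
    have hTS : x * y ∈ stab K := hT
    have hyS : y ∈ stab K := by
      have h2 : y - 1 ∈ stab K := hb
      simpa using (stab K).add_mem h2 (stab K).one_mem
    have hxS : x ∈ stab K := by
      have h2 := (stab K).mul_mem hTS ((stab K).pow_mem hyS (q - 1))
      rwa [mul_assoc, ← pow_succ', Nat.sub_add_cancel (Nat.one_le_iff_ne_zero.2 hq0), hyq,
        mul_one] at h2
    have hall : ∀ a, a ∈ stab K := by
      intro a
      induction a using TensorProduct.induction_on with
      | zero => exact (stab K).zero_mem
      | add a b ha hb => exact (stab K).add_mem ha hb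
      | tmul a b =>
        obtain ⟨P, rfl⟩ := hus a
        obtain ⟨Q, rfl⟩ := hvs b
        have e : (aeval u P) ⊗ₜ[k] (aeval v Q) = aeval x P * aeval y Q := by
          rw [hxdef, hydef, aeval_algHom_apply, aeval_algHom_apply]
          simp [iL, iR]
        rw [e]
        exact (stab K).mul_mem (aeval_mem_sub _ _ hxS _) (aeval_mem_sub _ _ hyS _)
    rw [eq_top_iff]
    intro a _
    simpa using hall a 1 h1

theorem tensor_iso {k B C B' : Type*} [Field k] (p : ℕ) [CharP k p] (hp : p.Prime) (α q : ℕ)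
    (hq : q = p ^ α) (r : ℕ) (hr1 : 1 ≤ r) (hrq : r ≤ q)
    [CommRing B] [Algebra k B] [CommRing C] [Algebra k C] [CommRing B'] [Algebra k B']
    [Module.Finite k B] [Module.Finite k C] [Module.Finite k B']
    (u : B) (u' : B') (v : C)
    (hu : (u - 1) ^ (q + 1) = 0) (hu' : (u' - 1) ^ (q - 1) = 0) (hv : (v - 1) ^ r = 0)
    (dB : Module.finrank k B = q + 1) (dB' : Module.finrank k B' = q - 1)
    (dC : Module.finrank k C = r)
    (hus : Function.Surjective (aeval (R := k) u))
    (hus' : Function.Surjective (aeval (R := k) u'))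
    (hvs : Function.Surjective (aeval (R := k) v)) :
    OpIso ((TensorProduct.map (LinearMap.mulLeft k u) (LinearMap.mulLeft k v)).prodMap
        (mulXop k ((X - 1) ^ (q - r))))
      ((TensorProduct.map (LinearMap.mulLeft k u') (LinearMap.mulLeft k v)).prodMap
        (mulXop k ((X - 1) ^ (r + q)))) := by
  obtain ⟨e, hb, h0, hgen⟩ := tensor_facts (k := k) p hp α q hq (q + 1) r hrq u v hu hv hus hvs
  obtain ⟨e', hb', h0', hgen'⟩ :=
    tensor_facts (k := k) p hp α q hq (q - 1) r hrq u' v hu' hv hus' hvs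
  rw [e, e']
  refine OpIso.final
    (case_plus (k := k) p hp α q hq inferInstance _ _ r hr1 hrq hb h0 ?_ hgen)
    (case_minus (k := k) p hp α q hq inferInstance _ _ r hr1 hrq hb' h0' ?_ hgen')
  · rw [← dB, ← dC]; exact Module.finrank_tensorProduct
  · rw [← dB', ← dC]; exact Module.finrank_tensorProduct

theorem quot_pow {k : Type*} [Field k] (n : ℕ) :
    ((Ideal.Quotient.mk (Ideal.span {((X - 1 : k[X])) ^ n}) X) - 1) ^ n = 0 := by
  rw [← map_one (Ideal.Quotient.mk _), ← map_sub, ← map_pow]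
  exact Ideal.Quotient.eq_zero_iff_mem.2 (Ideal.mem_span_singleton_self _)

theorem quot_surj {k : Type*} [Field k] (h : k[X]) :
    Function.Surjective (aeval (R := k) (Ideal.Quotient.mk (Ideal.span {h}) X)) := by
  intro a
  obtain ⟨R, rfl⟩ := Ideal.Quotient.mk_surjective a
  refine ⟨R, ?_⟩
  have := aeval_algHom_apply (Ideal.Quotient.mkₐ k (Ideal.span {h})) X R
  simpa using this

theorem stmt10 {k : Type*} [Field k] (p : ℕ) (hp : 0 < p) [CharP k p] (α : ℕ)
    (q : ℕ) (hq : q = p ^ α) (r : ℕ) (hr1 : 1 ≤ r) (hrq : r ≤ q) :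
    OpIso
      ((TensorProduct.map (mulXop k ((X - 1) ^ (q + 1))) (mulXop k ((X - 1) ^ r))).prodMap
        (mulXop k ((X - 1) ^ (q - r))))
      ((TensorProduct.map (mulXop k ((X - 1) ^ (q - 1))) (mulXop k ((X - 1) ^ r))).prodMap
        (mulXop k ((X - 1) ^ (r + q)))) := by
  have hpp : p.Prime := (CharP.char_is_prime_or_zero k p).resolve_right hp.ne'
  have f1 := finite_quot (k := k) (q + 1)
  have f2 := finite_quot (k := k) (q - 1)
  have f3 := finite_quot (k := k) r
  exact tensor_iso p hpp α q hq r hr1 hrq _ _ _ (quot_pow (q + 1)) (quot_pow (q - 1)) (quot_pow r)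
    (finrank_quot _) (finrank_quot _) (finrank_quot _) (quot_surj _) (quot_surj _) (quot_surj _)
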